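/- arXiv:2408.15476 — 2 statements merged into one kernel-verified Lean document; each statement's English description precedes it below -/
import Mathlib

section
/- Let A be a symmetric n×n matrix with entries in {0,1}, with eigenvalues λ_1 ≥ ⋯ ≥ λ_n. Then λ_2(A) − λ_n(A) = n/√2 holds if and only if there is a positive integer t with n = 4t and a permutation matrix P such that P·A·Pᵀ equals the 4×4 block matrix [[J,J,0,0],[J,0,J,0],[0,J,0,J],[0,0,J,J]], where each block is t×t and J denotes the t×t all-ones matrix; that is, if and only if A is (up to relabeling of vertices) the adjacency matrix of the t-blowup of the closed path P_4* (the path on 4 vertices with self-loops at its two endpoints). -/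
open Kronecker Matrix

lemma aux_perm {n : ℕ} (μ ν : Fin n → ℝ)
    (h : Finset.univ.val.map μ = Finset.univ.val.map ν) :
    ∃ σ : Fin n ≃ Fin n, ∀ i, ν (σ i) = μ i := by
  classical
  have hc : ∀ c, Nonempty ({a // μ a = c} ≃ {b // ν b = c}) := by
    intro c
    refine ⟨Fintype.equivOfCardEq ?_⟩
    have := congrArg (Multiset.count c) h
    rw [Multiset.count_map, Multiset.count_map] at this
    rw [Fintype.card_subtype, Fintype.card_subtype]
    simpa [Finset.card, eq_comm] using this
  let e := fun c => (hc c).some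
  exact ⟨Equiv.ofFiberEquiv e, fun i => Equiv.ofFiberEquiv_map e i⟩

lemma aux_spec {n : ℕ} (A : Matrix (Fin n) (Fin n) ℝ) (hA : A.IsHermitian)
    (μ : Fin n → ℝ)
    (hperm : Finset.univ.val.map μ = Finset.univ.val.map hA.eigenvalues) :
    ∃ w : Fin n → Fin n → ℝ, (∀ k l, A k l = ∑ i, μ i * (w i k * w i l)) ∧
      (∀ i j, ∑ k, w i k * w j k = if i = j then 1 else 0) ∧
      (∀ k l, ∑ i, w i k * w i l = if k = l then 1 else 0) := by
  obtain ⟨σ, hσ⟩ := aux_perm _ _ hperm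
  set U : Matrix (Fin n) (Fin n) ℝ := (hA.eigenvectorUnitary : Matrix (Fin n) (Fin n) ℝ) with hU
  have h1 : U * star U = 1 := Unitary.coe_mul_star_self _
  have h2 : star U * U = 1 := Unitary.coe_star_mul_self _
  have h3 : A = U * diagonal hA.eigenvalues * star U := by
    have := hA.spectral_theorem
    rw [Unitary.conjStarAlgAut_apply] at this
    simpa using this
  refine ⟨fun i k => U k (σ i), ?_, ?_, ?_⟩
  · intro k l
    have := congrFun (congrFun h3 k) l
    rw [this, Matrix.mul_apply, ← σ.sum_comp]
    refine Finset.sum_congr rfl fun i _ => ?_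
    rw [Matrix.mul_diagonal, hσ]
    simp [Matrix.star_apply]; ring
  · intro i j
    have := congrFun (congrFun h2 (σ i)) (σ j)
    simpa [Matrix.mul_apply, Matrix.star_apply, Matrix.one_apply] using this
  · intro k l
    have := congrFun (congrFun h1 k) l
    rw [Matrix.mul_apply, ← σ.sum_comp] at this
    simpa [Matrix.star_apply, Matrix.one_apply] using this

section
variable {n : ℕ} (A : Matrix (Fin n) (Fin n) ℝ) (μ : Fin n → ℝ) (w : Fin n → Fin n → ℝ)

lemma aux_eig (h1 : ∀ k l, A k l = ∑ i, μ i * (w i k * w i l))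
    (h2 : ∀ i j, ∑ k, w i k * w j k = if i = j then 1 else 0) (k j : Fin n) :
    ∑ l, A k l * w j l = μ j * w j k := by
  simp_rw [h1, Finset.sum_mul]
  rw [Finset.sum_comm]
  have : ∀ i, ∑ l, μ i * (w i k * w i l) * w j l = μ i * w i k * (if i = j then 1 else 0) := by
    intro i
    rw [← h2, Finset.mul_sum]
    exact Finset.sum_congr rfl fun l _ => by ring
  simp [this]

lemma aux_sq (h1 : ∀ k l, A k l = ∑ i, μ i * (w i k * w i l))
    (h2 : ∀ i j, ∑ k, w i k * w j k = if i = j then 1 else 0) :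
    ∑ k, ∑ l, A k l * A k l = ∑ i, μ i ^ 2 := by
  have : ∀ k, ∑ l, A k l * A k l = ∑ i, μ i ^ 2 * (w i k * w i k) := by
    intro k
    calc ∑ l, A k l * A k l = ∑ l, ∑ i, μ i * w i k * (A k l * w i l) := by
          refine Finset.sum_congr rfl fun l _ => ?_
          have h := congrArg (fun r => A k l * r) (h1 k l)
          simp only [Finset.mul_sum] at h
          rw [h]
          exact Finset.sum_congr rfl fun l _ => by ring
      _ = _ := by
          rw [Finset.sum_comm]
          refine Finset.sum_congr rfl fun i _ => ?_
          rw [← Finset.mul_sum, aux_eig A μ w h1 h2]; ring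
  simp_rw [this]
  rw [Finset.sum_comm]
  refine Finset.sum_congr rfl fun i _ => ?_
  rw [← Finset.mul_sum, h2]; simp

lemma aux_tr (h1 : ∀ k l, A k l = ∑ i, μ i * (w i k * w i l))
    (h2 : ∀ i j, ∑ k, w i k * w j k = if i = j then 1 else 0) :
    ∑ k, A k k = ∑ i, μ i := by
  simp_rw [h1]
  rw [Finset.sum_comm]
  refine Finset.sum_congr rfl fun i _ => ?_
  rw [← Finset.mul_sum, h2]; simp

lemma aux_row (h1 : ∀ k l, A k l = ∑ i, μ i * (w i k * w i l)) (k : Fin n) :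
    ∑ l, A k l = ∑ i, μ i * (w i k * ∑ l, w i l) := by
  simp_rw [h1]
  rw [Finset.sum_comm]
  refine Finset.sum_congr rfl fun i _ => ?_
  rw [← Finset.mul_sum, ← Finset.mul_sum]

lemma aux_tot (h1 : ∀ k l, A k l = ∑ i, μ i * (w i k * w i l)) :
    ∑ k, ∑ l, A k l = ∑ i, μ i * (∑ l, w i l) ^ 2 := by
  simp_rw [aux_row A μ w h1]
  rw [Finset.sum_comm]
  refine Finset.sum_congr rfl fun i _ => ?_
  rw [← Finset.mul_sum, ← Finset.sum_mul]; ring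

lemma aux_one (h3 : ∀ k l, ∑ i, w i k * w i l = if k = l then 1 else 0) (k : Fin n) :
    ∑ i, w i k * ∑ l, w i l = 1 := by
  simp_rw [Finset.mul_sum]
  rw [Finset.sum_comm]
  simp [h3]

lemma aux_onesq (h3 : ∀ k l, ∑ i, w i k * w i l = if k = l then 1 else 0) :
    ∑ i, (∑ l, w i l) ^ 2 = n := by
  have : ∑ k : Fin n, ∑ i, w i k * ∑ l, w i l = n := by simp [aux_one w h3]
  rw [← this, Finset.sum_comm]
  refine Finset.sum_congr rfl fun i _ => ?_
  rw [← Finset.sum_mul]; ring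

end

/-- combinatorial part -/
lemma aux_comb {n : ℕ} (hn : 0 < n) (B : Fin n → Fin n → ℝ) (hB : ∀ k l, B k l = 1 ∨ B k l = -1)
    (s : ℝ) (y z : Fin n → ℝ) (hyz : ∀ k l, B k l = s * (y k * y l - z k * z l))
    (hrow : ∀ k, ∑ l, B k l = 0) (htr : ∑ k, B k k = 0) :
    ∃ u v : Fin n → ℝ, (∀ k, u k = 1 ∨ u k = -1) ∧ (∀ k, v k = 1 ∨ v k = -1) ∧
      (∀ k l, B k l = (u k * u l + u k * v l + v k * u l - v k * v l) / 2) ∧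
      ∑ k, u k = 0 ∧ ∑ k, v k = 0 ∧ ∑ k, u k * v k = 0 := by
  have hi : ∃ i, B i i = 1 := by
    by_contra hcon
    push Not at hcon
    have : ∀ k, B k k = -1 := fun k => (hB k k).resolve_left (hcon k)
    simp [this] at htr; omega
  have hj : ∃ i, B i i = -1 := by
    by_contra hcon
    push Not at hcon
    have : ∀ k, B k k = 1 := fun k => (hB k k).resolve_right (hcon k)
    simp [this] at htr; omega
  obtain ⟨i, hi⟩ := hi
  obtain ⟨j, hj⟩ := hj
  have hsym : ∀ k l, B k l = B l k := fun k l => by rw [hyz, hyz]; ring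
  have hb2 : B i j * B i j = 1 := by rcases hB i j with h | h <;> rw [h] <;> norm_num
  have hdet : ∀ k l, B i i * (B j j * B k l - B j l * B k j) - B i j * (B j i * B k l - B j l * B k i)
      + B i l * (B j i * B k j - B j j * B k i) = 0 := by
    intro k l
    simp only [hyz]; ring
  have hform : ∀ k l, B k l = (B i k * B i l + B i k * (B i j * B j l) + (B i j * B j k) * B i l
      - (B i j * B j k) * (B i j * B j l)) / 2 := by
    intro k l
    have := hdet k l
    rw [hi, hj, hsym j i, hsym k i, hsym k j] at this
    linear_combination (-1/2) * this + (-1/2) * (B k l - B j k * B j l) * hb2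
  have hv : ∀ k, B i j * B j k = 1 ∨ B i j * B j k = -1 := by
    intro k
    rcases hB i j with h | h <;> rcases hB j k with h' | h' <;> rw [h, h'] <;> norm_num
  refine ⟨fun k => B i k, fun k => B i j * B j k, fun k => hB i k, hv, hform, hrow i, ?_, ?_⟩
  · rw [← Finset.mul_sum, hrow, mul_zero]
  · rw [← htr]
    refine Finset.sum_congr rfl fun k _ => ?_
    have h := hform k k
    have e1 : B i k * B i k = 1 := by rcases hB i k with h | h <;> rw [h] <;> norm_num
    have e2 : (B i j * B j k) * (B i j * B j k) = 1 := by
      rcases hv k with h | h <;> rw [h] <;> norm_num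
    rw [e1, e2] at h
    linarith

lemma aux_equiv {n t : ℕ} (f : Fin n → Fin 4)
    (hf : ∀ c, (Finset.univ.filter fun a => f a = c).card = t) :
    ∃ e : Fin n ≃ Fin 4 × Fin t, ∀ a, (e a).1 = f a := by
  have hc : ∀ c, Nonempty ({a // f a = c} ≃ {b : Fin 4 × Fin t // b.1 = c}) := by
    intro c
    refine ⟨Fintype.equivOfCardEq ?_⟩
    rw [Fintype.card_subtype, hf, Fintype.card_subtype]
    have : (Finset.univ.filter fun b : Fin 4 × Fin t => b.1 = c) = {c} ×ˢ Finset.univ := by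
      ext ⟨x, y⟩; simp [eq_comm]
    rw [this]; simp
  let e := fun c => (hc c).some
  exact ⟨Equiv.ofFiberEquiv e, fun i => Equiv.ofFiberEquiv_map e i⟩

lemma aux_class {n : ℕ} (hn : 0 < n) (A : Matrix (Fin n) (Fin n) ℝ) (u v : Fin n → ℝ)
    (hu : ∀ k, u k = 1 ∨ u k = -1) (hv : ∀ k, v k = 1 ∨ v k = -1)
    (hform : ∀ k l, 2 * A k l - 1 = (u k * u l + u k * v l + v k * u l - v k * v l) / 2)
    (su : ∑ k, u k = 0) (sv : ∑ k, v k = 0) (suv : ∑ k, u k * v k = 0) :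
    ∃ t : ℕ, 0 < t ∧ n = 4 * t ∧ ∃ e : Fin n ≃ Fin 4 × Fin t,
      ∀ a b, A a b =
        ((!![1, 1, 0, 0; 1, 0, 1, 0; 0, 1, 0, 1; 0, 0, 1, 1] : Matrix (Fin 4) (Fin 4) ℝ) ⊗ₖ
          (Matrix.of fun (_ : Fin t) (_ : Fin t) => (1 : ℝ))) (e a) (e b) := by
  classical
  let f : Fin n → Fin 4 := fun k =>
    if u k = 1 then (if v k = 1 then 0 else 1) else (if v k = 1 then 2 else 3)
  have n1 : ¬ ((-1 : ℝ) = 1) := by norm_num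
  have hcard : ∀ c, 4 * ((Finset.univ.filter fun a => f a = c).card : ℝ) = n := by
    intro c
    have key : ∀ (p q r : ℝ), (∀ k, (if f k = c then (4:ℝ) else 0) = 1 + p * u k + q * v k + r * (u k * v k)) →
        4 * ((Finset.univ.filter fun a => f a = c).card : ℝ) = n := by
      intro p q r h
      have : ∑ k, (if f k = c then (4:ℝ) else 0) = n := by
        rw [Finset.sum_congr rfl fun k _ => h k]
        simp only [Finset.sum_add_distrib, ← Finset.mul_sum, su, sv, suv]
        simp
      rw [← this, ← Finset.sum_filter]; simp [mul_comm]
    fin_cases c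
    · refine key 1 1 1 fun k => ?_
      rcases hu k with h | h <;> rcases hv k with h' | h' <;> simp [f, h, h', n1] <;> norm_num
    · refine key 1 (-1) (-1) fun k => ?_
      rcases hu k with h | h <;> rcases hv k with h' | h' <;> simp [f, h, h', n1] <;> norm_num
    · refine key (-1) 1 (-1) fun k => ?_
      rcases hu k with h | h <;> rcases hv k with h' | h' <;> simp [f, h, h', n1] <;> norm_num
    · refine key (-1) (-1) 1 fun k => ?_
      rcases hu k with h | h <;> rcases hv k with h' | h' <;> simp [f, h, h', n1] <;> norm_num
  have hcard' : ∀ c, 4 * (Finset.univ.filter fun a => f a = c).card = n := by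
    intro c; exact_mod_cast hcard c
  have h0 := hcard' 0
  obtain ⟨e, he⟩ := aux_equiv (t := (Finset.univ.filter fun a => f a = 0).card) f (by
    intro c
    have := hcard' c
    omega)
  refine ⟨_, by omega, h0.symm, e, ?_⟩
  intro a b
  rw [Matrix.kroneckerMap_apply, he, he]
  have h := hform a b
  rcases hu a with h1 | h1 <;> rcases hv a with h2 | h2 <;> rcases hu b with h3 | h3 <;>
    rcases hv b with h4 | h4 <;> rw [h1, h2, h3, h4] at h <;> simp [f, h1, h2, h3, h4, n1] <;> linarith

lemma aux_split {n : ℕ} (F : Fin n → ℝ) (i j k : Fin n) (hij : i ≠ j) (hik : i ≠ k) (hjk : j ≠ k) :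
    ∑ a, F a = F i + F j + F k + ∑ a ∈ Finset.univ \ {i, j, k}, F a := by
  rw [← Finset.sum_sdiff (Finset.subset_univ {i, j, k}), Finset.sum_insert (by simp [hij, hik]),
    Finset.sum_insert (by simp [hjk]), Finset.sum_singleton]
  ring

lemma aux_split0 {n : ℕ} (F : Fin n → ℝ) (i j k : Fin n) (hij : i ≠ j) (hik : i ≠ k) (hjk : j ≠ k)
    (h : ∀ a, a ≠ i → a ≠ j → a ≠ k → F a = 0) :
    ∑ a, F a = F i + F j + F k := by
  rw [aux_split F i j k hij hik hjk, Finset.sum_eq_zero, add_zero]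
  intro a ha
  simp only [Finset.mem_sdiff, Finset.mem_univ, Finset.mem_insert, Finset.mem_singleton, not_or,
    true_and] at ha
  exact h a ha.1 ha.2.1 ha.2.2

lemma aux_mem {n : ℕ} (A : Matrix (Fin n) (Fin n) ℝ) (μ : Fin n → ℝ) (w : Fin n → Fin n → ℝ)
    (h1 : ∀ k l, A k l = ∑ i, μ i * (w i k * w i l))
    (h2 : ∀ i j, ∑ k, w i k * w j k = if i = j then 1 else 0)
    (h3 : ∀ k l, ∑ i, w i k * w i l = if k = l then 1 else 0)
    (x : Fin n → ℝ) (r : ℝ) (hx : ∀ k, ∑ l, A k l * x l = r * x k) (k0 : Fin n) (hk0 : x k0 ≠ 0) :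
    ∃ i, μ i = r := by
  by_contra hcon
  push Not at hcon
  have hsym : ∀ k l, A k l = A l k := fun k l => by
    rw [h1, h1]; exact Finset.sum_congr rfl fun i _ => by ring
  have hp : ∀ i, ∑ k, x k * w i k = 0 := by
    intro i
    have e1 : r * ∑ k, x k * w i k = μ i * ∑ k, x k * w i k := by
      calc r * ∑ k, x k * w i k = ∑ k, ∑ l, A k l * x l * w i k := by
            rw [Finset.mul_sum]
            refine Finset.sum_congr rfl fun k _ => ?_
            rw [← Finset.sum_mul, hx]; ring
        _ = ∑ l, x l * ∑ k, A l k * w i k := by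
            rw [Finset.sum_comm]
            refine Finset.sum_congr rfl fun l _ => ?_
            rw [Finset.mul_sum]
            refine Finset.sum_congr rfl fun k _ => ?_
            rw [hsym k l]; ring
        _ = _ := by
            rw [Finset.mul_sum]
            refine Finset.sum_congr rfl fun l _ => ?_
            rw [aux_eig A μ w h1 h2]; ring
    have e2 : (μ i - r) * ∑ k, x k * w i k = 0 := by linarith
    exact (mul_eq_zero.mp e2).resolve_left (sub_ne_zero.mpr (hcon i))
  apply hk0
  calc x k0 = ∑ l, x l * ∑ i, w i l * w i k0 := by simp [h3]
    _ = ∑ i, (∑ l, x l * w i l) * w i k0 := by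
        simp_rw [Finset.mul_sum, Finset.sum_mul]
        rw [Finset.sum_comm]
        exact Finset.sum_congr rfl fun i _ => Finset.sum_congr rfl fun l _ => by ring
    _ = 0 := by simp [hp]

lemma aux_forward (n : ℕ) (hn : 2 ≤ n)
    (A : Matrix (Fin n) (Fin n) ℝ)
    (hA01 : ∀ a b, A a b = 0 ∨ A a b = 1)
    (μ : Fin n → ℝ) (hmono : Antitone μ) (w : Fin n → Fin n → ℝ)
    (h1 : ∀ k l, A k l = ∑ i, μ i * (w i k * w i l))
    (h2 : ∀ i j, ∑ k, w i k * w j k = if i = j then 1 else 0)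
    (h3 : ∀ k l, ∑ i, w i k * w i l = if k = l then 1 else 0)
    (j1 j2 : Fin n) (hj1 : j1.val = 1) (hj2 : j2.val = n - 1)
    (h : μ j1 - μ j2 = (n : ℝ) / Real.sqrt 2) :
    ∃ t : ℕ, 0 < t ∧ n = 4 * t ∧ ∃ e : Fin n ≃ Fin 4 × Fin t,
      ∀ a b, A a b =
        ((!![1, 1, 0, 0; 1, 0, 1, 0; 0, 1, 0, 1; 0, 0, 1, 1] : Matrix (Fin 4) (Fin 4) ℝ) ⊗ₖ
          (Matrix.of fun (_ : Fin t) (_ : Fin t) => (1 : ℝ))) (e a) (e b) := by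
  have hlt1 : 1 < n := hn
  have hlt2 : n - 1 < n := Nat.sub_lt (lt_of_lt_of_le two_pos hn) one_pos
  obtain rfl : j1 = ⟨1, hlt1⟩ := Fin.ext hj1
  obtain rfl : j2 = ⟨n - 1, hlt2⟩ := Fin.ext hj2
  have hnpos : (0 : ℝ) < n := by exact_mod_cast (by omega : 0 < n)
  have hs2 : Real.sqrt 2 * Real.sqrt 2 = 2 := Real.mul_self_sqrt (by norm_num)
  have hs0 : 0 < Real.sqrt 2 := by positivity
  have hn3 : 3 ≤ n := by
    by_contra hlt
    have h2' : n = 2 := by omega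
    subst h2'
    have : (0 : ℝ) < ((2 : ℕ) : ℝ) / Real.sqrt 2 := by positivity
    rw [← h] at this
    simp at this
  have hsq : (μ ⟨1, by omega⟩ - μ ⟨n - 1, by omega⟩) ^ 2 = (n : ℝ) ^ 2 / 2 := by
    rw [h, div_pow, Real.sq_sqrt (by norm_num)]
  have hpos : 0 < μ ⟨1, by omega⟩ - μ ⟨n - 1, by omega⟩ := by rw [h]; positivity
  obtain ⟨i0, hi0⟩ : ∃ i0 : Fin n, i0 = ⟨0, by omega⟩ := ⟨_, rfl⟩
  obtain ⟨i1, hi1⟩ : ∃ i1 : Fin n, i1 = ⟨1, by omega⟩ := ⟨_, rfl⟩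
  obtain ⟨i2, hi2⟩ : ∃ i2 : Fin n, i2 = ⟨n - 1, by omega⟩ := ⟨_, rfl⟩
  rw [← hi1, ← hi2] at hsq hpos
  have d01 : i0 ≠ i1 := by rw [hi0, hi1]; simp [Fin.ext_iff]
  have d02 : i0 ≠ i2 := by rw [hi0, hi2]; simp only [ne_eq, Fin.ext_iff]; omega
  have d12 : i1 ≠ i2 := by rw [hi1, hi2]; simp only [ne_eq, Fin.ext_iff]; omega
  have hle0 : ∀ i, μ i ≤ μ i0 := fun i => hmono (by rw [hi0, Fin.le_def]; simp)
  have hle1 : ∀ i, i ≠ i0 → μ i ≤ μ i1 := fun i hi => hmono (by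
    rw [hi0] at hi
    rw [hi1, Fin.le_def]
    simp only [ne_eq, Fin.ext_iff] at hi ⊢
    omega)
  have eS := aux_sq A μ w h1 h2
  have eT := aux_tot A μ w h1
  have eSq : ∑ k, ∑ l, A k l * A k l = ∑ k, ∑ l, A k l := by
    refine Finset.sum_congr rfl fun k _ => Finset.sum_congr rfl fun l _ => ?_
    rcases hA01 k l with h | h <;> rw [h] <;> norm_num
  have eO := aux_onesq w h3
  have eD : ∑ i, (μ i0 - μ i) * (∑ l, w i l) ^ 2 = n * μ i0 - ∑ i, μ i ^ 2 := by
    rw [← eS, eSq, eT, ← eO, Finset.sum_mul, ← Finset.sum_sub_distrib]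
    exact Finset.sum_congr rfl fun i _ => by ring
  have eDnn : ∀ i ∈ Finset.univ, 0 ≤ (μ i0 - μ i) * (∑ l, w i l) ^ 2 := fun i _ =>
    mul_nonneg (sub_nonneg.mpr (hle0 i)) (sq_nonneg _)
  have eD0 := Finset.sum_nonneg eDnn
  have eR := aux_split (fun i => μ i ^ 2) i0 i1 i2 d01 d02 d12
  have eRnn : ∀ i ∈ Finset.univ \ {i0, i1, i2}, 0 ≤ μ i ^ 2 := fun i _ => sq_nonneg _
  have eR0 := Finset.sum_nonneg eRnn
  have q1 := sq_nonneg (μ i0 - n / 2)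
  have q2 := sq_nonneg (μ i1 + μ i2)
  have hsum : (μ i0 - n / 2) ^ 2 + (μ i1 + μ i2) ^ 2 / 2 + ∑ i ∈ Finset.univ \ {i0, i1, i2}, μ i ^ 2
      + ∑ i, (μ i0 - μ i) * (∑ l, w i l) ^ 2 = 0 := by
    rw [eD, eR]; linear_combination (-1/2) * hsq
  have r1 : (μ i0 - n / 2) ^ 2 = 0 := by linarith
  have r2 : (μ i1 + μ i2) ^ 2 = 0 := by linarith
  have r3 : ∑ i ∈ Finset.univ \ {i0, i1, i2}, μ i ^ 2 = 0 := by linarith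
  have r4 : ∑ i, (μ i0 - μ i) * (∑ l, w i l) ^ 2 = 0 := by linarith
  have m0 : μ i0 = n / 2 := by have := pow_eq_zero_iff (two_ne_zero) |>.mp r1; linarith
  have m2 : μ i2 = - μ i1 := by have := pow_eq_zero_iff (two_ne_zero) |>.mp r2; linarith
  have mz : ∀ i, i ≠ i0 → i ≠ i1 → i ≠ i2 → μ i = 0 := by
    intro i a b c
    have := (Finset.sum_eq_zero_iff_of_nonneg eRnn).mp r3 i (by simp [a, b, c])
    exact pow_eq_zero_iff (two_ne_zero) |>.mp this
  have m1 : μ i1 < μ i0 := by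
    rw [m2] at hsq
    rw [m0]
    nlinarith
  have sz : ∀ i, i ≠ i0 → ∑ l, w i l = 0 := by
    intro i hi
    have := (Finset.sum_eq_zero_iff_of_nonneg eDnn).mp r4 i (Finset.mem_univ _)
    have hlt : μ i < μ i0 := lt_of_le_of_lt (hle1 i hi) m1
    rcases mul_eq_zero.mp this with h | h
    · linarith
    · exact pow_eq_zero_iff (two_ne_zero) |>.mp h
  have hw0 : ∀ k, w i0 k * ∑ l, w i0 l = 1 := by
    intro k
    rw [← aux_one w h3 k]
    symm
    apply Finset.sum_eq_single i0
    · intro i _ hi; rw [sz i hi, mul_zero]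
    · simp
  have hs0n : (∑ l, w i0 l) ^ 2 = n := by
    rw [← eO]
    symm
    apply Finset.sum_eq_single i0
    · intro i _ hi; rw [sz i hi]; simp
    · simp
  have hrow : ∀ k, ∑ l, A k l = n / 2 := by
    intro k
    rw [aux_row A μ w h1 k, Finset.sum_eq_single i0, hw0, m0, mul_one]
    · intro i _ hi; rw [sz i hi]; simp
    · simp
  have htr : ∑ k, A k k = n / 2 := by
    rw [aux_tr A μ w h1 h2, aux_split0 μ i0 i1 i2 d01 d02 d12 mz, m0, m2]; ring
  have hAf : ∀ k l, 2 * A k l - 1 = (2 * μ i1) * (w i1 k * w i1 l - w i2 k * w i2 l) := by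
    intro k l
    rw [h1 k l, aux_split0 (fun i => μ i * (w i k * w i l)) i0 i1 i2 d01 d02 d12
      (fun a b c d => by simp [mz a b c d])]
    simp only [m0, m2]
    have : (n : ℝ) * (w i0 k * w i0 l) = 1 := by
      rw [← hs0n]
      linear_combination (w i0 l * ∑ l, w i0 l) * hw0 k + hw0 l
    linear_combination this
  obtain ⟨u, v, hu, hv, hf, su, sv, suv⟩ := aux_comb (by omega) (fun k l => 2 * A k l - 1)
    (by intro k l; rcases hA01 k l with h | h <;> simp only [h] <;> norm_num)
    _ _ _ hAf
    (by intro k; rw [Finset.sum_sub_distrib, ← Finset.mul_sum, hrow]; simp; ring)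
    (by rw [Finset.sum_sub_distrib, ← Finset.mul_sum, htr]; simp; ring)
  exact aux_class (by omega) A u v hu hv hf su sv suv

lemma aux_backward (n : ℕ) (hn : 2 ≤ n)
    (A : Matrix (Fin n) (Fin n) ℝ)
    (hA01 : ∀ a b, A a b = 0 ∨ A a b = 1)
    (μ : Fin n → ℝ) (hmono : Antitone μ) (w : Fin n → Fin n → ℝ)
    (h1 : ∀ k l, A k l = ∑ i, μ i * (w i k * w i l))
    (h2 : ∀ i j, ∑ k, w i k * w j k = if i = j then 1 else 0)
    (h3 : ∀ k l, ∑ i, w i k * w i l = if k = l then 1 else 0)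
    (t : ℕ) (ht : 0 < t) (hnt : n = 4 * t) (e : Fin n ≃ Fin 4 × Fin t)
    (he : ∀ a b, A a b =
        ((!![1, 1, 0, 0; 1, 0, 1, 0; 0, 1, 0, 1; 0, 0, 1, 1] : Matrix (Fin 4) (Fin 4) ℝ) ⊗ₖ
          (Matrix.of fun (_ : Fin t) (_ : Fin t) => (1 : ℝ))) (e a) (e b))
    (j1 j2 : Fin n) (hj1 : j1.val = 1) (hj2 : j2.val = n - 1) :
    μ j1 - μ j2 = (n : ℝ) / Real.sqrt 2 := by
  have hlt1 : 1 < n := hn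
  have hlt2 : n - 1 < n := Nat.sub_lt (lt_of_lt_of_le two_pos hn) one_pos
  obtain rfl : j1 = ⟨1, hlt1⟩ := Fin.ext hj1
  obtain rfl : j2 = ⟨n - 1, hlt2⟩ := Fin.ext hj2
  have htpos : (0 : ℝ) < t := by exact_mod_cast ht
  have hs2 : Real.sqrt 2 * Real.sqrt 2 = 2 := Real.mul_self_sqrt (by norm_num)
  have hs0 : 0 < Real.sqrt 2 := by positivity
  have hs12 : Real.sqrt 2 < 2 := by nlinarith
  have hsum : ∀ (x : Fin 4 → ℝ) a, ∑ b, A a b * x (e b).1 = t * ∑ c,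
      (!![1, 1, 0, 0; 1, 0, 1, 0; 0, 1, 0, 1; 0, 0, 1, 1] : Matrix (Fin 4) (Fin 4) ℝ) (e a).1 c * x c := by
    intro x a
    simp_rw [he a, Matrix.kroneckerMap_apply]
    rw [e.sum_comp (fun p : Fin 4 × Fin t =>
      (!![1, 1, 0, 0; 1, 0, 1, 0; 0, 1, 0, 1; 0, 0, 1, 1] : Matrix (Fin 4) (Fin 4) ℝ) (e a).1 p.1 *
        (Matrix.of fun (_ : Fin t) (_ : Fin t) => (1 : ℝ)) (e a).2 p.2 * x p.1),
      Fintype.sum_prod_type, Finset.mul_sum]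
    refine Finset.sum_congr rfl fun c _ => ?_
    simp
  have hmem : ∀ (x : Fin 4 → ℝ) (r : ℝ), x 1 ≠ 0 → (∀ d, ∑ c,
      (!![1, 1, 0, 0; 1, 0, 1, 0; 0, 1, 0, 1; 0, 0, 1, 1] : Matrix (Fin 4) (Fin 4) ℝ) d c * x c = r * x d) →
      ∃ i, μ i = t * r := by
    intro x r hx hr
    refine aux_mem A μ w h1 h2 h3 (fun a => x (e a).1) (t * r) ?_ (e.symm (1, ⟨0, ht⟩)) (by simpa using hx)
    intro k
    rw [hsum, hr]; ring
  obtain ⟨i, hi⟩ := hmem (fun _ => 1) 2 (by norm_num) (by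
    intro d; fin_cases d <;> simp [Fin.sum_univ_four] <;> norm_num)
  obtain ⟨j, hj⟩ := hmem ![1 + √2, 1, -1, -(1 + √2)] (√2) (by simp) (by
    intro d; fin_cases d <;> simp [Fin.sum_univ_four] <;> linarith)
  obtain ⟨k, hk⟩ := hmem ![1 - √2, 1, -1, -(1 - √2)] (-√2) (by simp) (by
    intro d; fin_cases d <;> simp [Fin.sum_univ_four] <;> linarith)
  have hrow : ∀ a, ∑ b, A a b = 2 * t := by
    intro a
    have := hsum (fun _ => 1) a
    simp only [mul_one] at this
    rw [this]
    generalize (e a).1 = d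
    fin_cases d <;> simp [Fin.sum_univ_four] <;> ring
  have hS : ∑ i, μ i ^ 2 = 8 * (t : ℝ) ^ 2 := by
    rw [← aux_sq A μ w h1 h2]
    have eSq : ∑ k, ∑ l, A k l * A k l = ∑ k, ∑ l, A k l := by
      refine Finset.sum_congr rfl fun k _ => Finset.sum_congr rfl fun l _ => ?_
      rcases hA01 k l with h | h <;> rw [h] <;> norm_num
    rw [eSq]
    simp only [hrow]
    simp [hnt]; ring
  have b1 : (t : ℝ) * √2 < t * 2 := by nlinarith
  have b2 : 0 < (t : ℝ) * √2 := by positivity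
  have dij : i ≠ j := by rintro rfl; linarith
  have dik : i ≠ k := by rintro rfl; linarith
  have djk : j ≠ k := by rintro rfl; linarith
  have hz : ∀ a, a ≠ i → a ≠ j → a ≠ k → μ a = 0 := by
    intro a x y z
    have eR := aux_split (fun i => μ i ^ 2) i j k dij dik djk
    have eRnn : ∀ b ∈ Finset.univ \ {i, j, k}, 0 ≤ μ b ^ 2 := fun i _ => sq_nonneg _
    rw [hS] at eR
    simp only [hi, hj, hk] at eR
    have r3 : ∑ b ∈ Finset.univ \ {i, j, k}, μ b ^ 2 = 0 := by
      linear_combination -eR - 2 * (t : ℝ) ^ 2 * hs2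
    have := (Finset.sum_eq_zero_iff_of_nonneg eRnn).mp r3 a (by simp [x, y, z])
    exact pow_eq_zero_iff (two_ne_zero) |>.mp this
  have hall : ∀ a, a = i ∨ a = j ∨ a = k ∨ μ a = 0 := by
    intro a
    by_cases x : a = i
    · exact Or.inl x
    by_cases y : a = j
    · exact Or.inr (Or.inl y)
    by_cases z : a = k
    · exact Or.inr (Or.inr (Or.inl z))
    exact Or.inr (Or.inr (Or.inr (hz a x y z)))
  have hlast : μ ⟨n - 1, by omega⟩ = -(t * √2) := by
    have hle : μ ⟨n - 1, by omega⟩ ≤ μ k := hmono (by rw [Fin.le_def]; simp only; omega)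
    rcases hall ⟨n - 1, by omega⟩ with h | h | h | h
    · rw [h] at hle; linarith
    · rw [h] at hle; linarith
    · rw [h, hk]; ring
    · linarith
  have hj1 : 1 ≤ j.val := by
    by_contra hlt
    have : μ i ≤ μ j := hmono (by rw [Fin.le_def]; omega)
    linarith
  have hfst : μ ⟨1, by omega⟩ = t * √2 := by
    have hle : μ j ≤ μ ⟨1, by omega⟩ := hmono (by rw [Fin.le_def]; exact hj1)
    have hle0 : μ ⟨1, by omega⟩ ≤ μ ⟨0, by omega⟩ := hmono (by rw [Fin.le_def]; simp)
    rcases hall ⟨1, by omega⟩ with h | h | h | h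
    · rw [h] at hle0
      rcases hall ⟨0, by omega⟩ with h' | h' | h' | h'
      · rw [← h, Fin.ext_iff] at h'; simp at h'
      · rw [h'] at hle0; linarith
      · rw [h'] at hle0; linarith
      · linarith
    · rw [h, hj]
    · rw [h] at hle; linarith
    · linarith
  rw [hfst, hlast, eq_div_iff hs0.ne', hnt]
  push_cast
  linear_combination 2 * (t : ℝ) * hs2

/-- For a symmetric `n × n` `(0,1)`-matrix `A` with eigenvalues `μ` in
nonincreasing order, `λ_2(A) - λ_n(A) = n / √2` holds if and only if `n = 4t` for some
`t ≥ 1` and, up to a relabeling of the vertices, `A` is the adjacency matrix of the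
`t`-blowup of the closed path `P₄*`, i.e. `A` is conjugate by a permutation to
`P ⊗ J_t` where `P = !![1,1,0,0; 1,0,1,0; 0,1,0,1; 0,0,1,1]`. -/
theorem spread_10_equality_iff_blowup (n : ℕ) (hn : 2 ≤ n)
    (A : Matrix (Fin n) (Fin n) ℝ) (hA : A.IsHermitian)
    (hA01 : ∀ a b, A a b = 0 ∨ A a b = 1)
    (μ : Fin n → ℝ) (hmono : Antitone μ)
    (hperm : Finset.univ.val.map μ = Finset.univ.val.map hA.eigenvalues) :
    μ ⟨1, by omega⟩ - μ ⟨n - 1, by omega⟩ = (n : ℝ) / Real.sqrt 2 ↔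
    ∃ t : ℕ, 0 < t ∧ n = 4 * t ∧ ∃ e : Fin n ≃ Fin 4 × Fin t,
      ∀ a b, A a b =
        ((!![1, 1, 0, 0; 1, 0, 1, 0; 0, 1, 0, 1; 0, 0, 1, 1] : Matrix (Fin 4) (Fin 4) ℝ) ⊗ₖ
          (Matrix.of fun (_ : Fin t) (_ : Fin t) => (1 : ℝ))) (e a) (e b) := by
  obtain ⟨w, h1, h2, h3⟩ := aux_spec A hA μ hperm
  constructor
  · exact aux_forward n hn A hA01 μ hmono w h1 h2 h3 _ _ rfl rfl
  · rintro ⟨t, ht, hnt, e, he⟩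
    exact aux_backward n hn A hA01 μ hmono w h1 h2 h3 t ht hnt e he _ _ rfl rfl
end

section
/- Let j ≥ 0 and t ≥ 1 be integers, and let A = diag(J_{j+2} − I_{j+2}, J_{j+1}) ⊗ J_t be the adjacency matrix of the t-blowup of the graph K_{j+2} ∪ K*_{j+1}, of order n = (2j+3)t. Then λ_2(A) − λ_{n−j}(A) = (j+2)·t; in particular, (λ_2(A) − λ_{n−j}(A))/n = (j+2)/(2j+3), so for every n divisible by 2j+3 there is a symmetric n×n (0,1)-matrix whose (1,j)-spread is at least n·(j+2)/(2j+3). -/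
open Kronecker Matrix

open Polynomial in
lemma aux_charpoly_J (m : ℕ) (t : ℝ) :
    (Matrix.of fun (_ : Fin (m + 1)) (_ : Fin (m + 1)) => t).charpoly =
      X ^ m * (X - C (((m : ℝ) + 1) * t)) := by
  have h : (Matrix.of fun (_ : Fin (m + 1)) (_ : Fin (m + 1)) => t) =
      vecMulVec (fun _ => t) (fun _ => 1) := by
    ext a b; simp [vecMulVec_apply]
  rw [h, charpoly_vecMulVec]
  simp [dotProduct, smul_eq_C_mul]
  ring

open Polynomial in
lemma aux_charpoly (j t : ℕ) (ht : 1 ≤ t) :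
    ((Matrix.fromBlocks
        ((Matrix.of fun (_ : Fin (j + 2)) (_ : Fin (j + 2)) => (1 : ℝ)) - 1) 0 0
        (Matrix.of fun (_ : Fin (j + 1)) (_ : Fin (j + 1)) => (1 : ℝ))) ⊗ₖ
      (Matrix.of fun (_ : Fin t) (_ : Fin t) => (1 : ℝ))).charpoly =
    (X - C (((j : ℝ) + 1) * t)) ^ 2 * (X - C 0) ^ ((2 * j + 3) * t - j - 3) *
      (X - C (-(t : ℝ))) ^ (j + 1) := by
  set M : Matrix (Fin (j + 2) ⊕ Fin (j + 1)) (Fin (j + 2) ⊕ Fin (j + 1)) ℝ := (Matrix.fromBlocks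
        ((Matrix.of fun (_ : Fin (j + 2)) (_ : Fin (j + 2)) => (1 : ℝ)) - 1) 0 0
        (Matrix.of fun (_ : Fin (j + 1)) (_ : Fin (j + 1)) => (1 : ℝ))) with hM
  let P : Matrix ((Fin (j + 2) ⊕ Fin (j + 1)) × Fin t) (Fin (j + 2) ⊕ Fin (j + 1)) ℝ :=
    Matrix.of fun a b => M a.1 b
  let Q : Matrix (Fin (j + 2) ⊕ Fin (j + 1)) ((Fin (j + 2) ⊕ Fin (j + 1)) × Fin t) ℝ :=
    Matrix.of fun b c => if b = c.1 then 1 else 0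
  have hPQ : M ⊗ₖ (Matrix.of fun (_ : Fin t) (_ : Fin t) => (1 : ℝ)) = P * Q := by
    ext a b
    simp [P, Q, Matrix.mul_apply, kroneckerMap_apply, -Fintype.sum_sum_type]
  have hQP : Q * P = Matrix.fromBlocks
        ((Matrix.of fun (_ : Fin (j + 2)) (_ : Fin (j + 2)) => (t : ℝ)) - scalar _ (t : ℝ)) 0 0
        (Matrix.of fun (_ : Fin (j + 1)) (_ : Fin (j + 1)) => (t : ℝ)) := by
    have h1 : Q * P = (t : ℝ) • M := by
      ext a b
      simp [P, Q, Matrix.mul_apply, Fintype.sum_prod_type, -Fintype.sum_sum_type]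
    rw [h1, hM, fromBlocks_smul]
    congr 1
    · ext a b
      by_cases h : a = b <;> simp [h, Matrix.scalar_apply, Matrix.diagonal_apply, -map_natCast]
    · simp
    · simp
    · ext a b; simp
  have hmul : 2 * j + 3 ≤ (2 * j + 3) * t := Nat.le_mul_of_pos_right _ ht
  rw [hPQ, charpoly_mul_comm_of_le, hQP, charpoly_fromBlocks_zero₁₂, charpoly_sub_scalar,
    aux_charpoly_J (j + 1), aux_charpoly_J j]
  · have e : Fintype.card ((Fin (j + 2) ⊕ Fin (j + 1)) × Fin t) -
        Fintype.card (Fin (j + 2) ⊕ Fin (j + 1)) + j = (2 * j + 3) * t - j - 3 := by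
      simp only [Fintype.card_prod, Fintype.card_sum, Fintype.card_fin]
      rw [show j + 2 + (j + 1) = 2 * j + 3 by ring]
      omega
    rw [← e, pow_add]
    simp
    ring
  · simp only [Fintype.card_prod, Fintype.card_sum, Fintype.card_fin]
    rw [show j + 2 + (j + 1) = 2 * j + 3 by ring]
    exact hmul

open Polynomial in
lemma aux_spread {α : Type*} [Fintype α] [DecidableEq α] (B : Matrix α α ℝ) (hB : B.IsHermitian)
    (j t n : ℕ) (hn : n = (2 * j + 3) * t) (ht : 1 ≤ t)
    (hc : B.charpoly = (X - C (((j : ℝ) + 1) * t)) ^ 2 * (X - C 0) ^ ((2 * j + 3) * t - j - 3) *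
      (X - C (-(t : ℝ))) ^ (j + 1))
    (μ : Fin n → ℝ) (hμ : Antitone μ)
    (he : Finset.univ.val.map μ = Finset.univ.val.map hB.eigenvalues)
    (h1 : 1 < n) (h2 : n - j - 1 < n) :
    μ ⟨1, h1⟩ - μ ⟨n - j - 1, h2⟩ = ((j : ℝ) + 2) * t := by
  have hmul : 2 * j + 3 ≤ (2 * j + 3) * t := Nat.le_mul_of_pos_right _ ht
  rw [← hn] at hmul hc
  have hr : B.charpoly.roots = Finset.univ.val.map hB.eigenvalues := by
    rw [hB.roots_charpoly_eq_eigenvalues]; rfl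
  set L : List ℝ := List.replicate 2 (((j : ℝ) + 1) * t) ++ List.replicate (n - j - 3) 0 ++
    List.replicate (j + 1) (-(t : ℝ)) with hL
  have hroots : B.charpoly.roots = (L : Multiset ℝ) := by
    have hpos : ∀ (a : ℝ) k, (X - C a) ^ k ≠ 0 := fun a k => pow_ne_zero _ (X_sub_C_ne_zero a)
    rw [hc, roots_mul (mul_ne_zero (mul_ne_zero (hpos _ _) (hpos _ _)) (hpos _ _)),
      roots_mul (mul_ne_zero (hpos _ _) (hpos _ _))]
    simp only [roots_pow, roots_X_sub_C, Multiset.nsmul_singleton, hL, ← Multiset.coe_add,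
      Multiset.coe_replicate]
  have hperm : (List.ofFn μ).Perm L := by
    rw [← Multiset.coe_eq_coe, ← hroots, hr, ← he, Fin.univ_val_map]
  have ht0 : (0 : ℝ) ≤ t := Nat.cast_nonneg t
  have hs : L.Pairwise (· ≥ ·) := by
    have ha : (0 : ℝ) ≤ ((j : ℝ) + 1) * t := by positivity
    rw [hL, List.pairwise_append, List.pairwise_append]
    refine ⟨⟨?_, ?_, ?_⟩, ?_, ?_⟩
    · simp
    · simp [List.pairwise_replicate]
    · intro a h b h'
      rw [List.eq_of_mem_replicate h, List.eq_of_mem_replicate h']; exact ha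
    · simp [List.pairwise_replicate]
    · intro a h b h'
      rw [List.eq_of_mem_replicate h']
      rcases List.mem_append.1 h with h | h <;> rw [List.eq_of_mem_replicate h] <;> linarith
  have heq : List.ofFn μ = L :=
    hperm.eq_of_pairwise' (List.sortedGE_iff_pairwise.1 hμ.sortedGE_ofFn) hs
  have key : ∀ i (hi : i < n), μ ⟨i, hi⟩ = L[i]'(by rw [← heq]; simpa using hi) := by
    intro i hi
    simp [← heq]
  rw [key, key]
  have e1 : L[1]'(by rw [← heq]; simpa using h1) = ((j : ℝ) + 1) * t := by
    simp [hL]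
  have e2 : L[n - j - 1]'(by rw [← heq]; simpa using h2) = -(t : ℝ) := by
    simp only [hL]
    rw [List.getElem_append_right (by simp; omega)]
    simp
  rw [e1, e2]; ring

/-- For the adjacency matrix `A = diag(J_{j+2} - I_{j+2}, J_{j+1}) ⊗ J_t` of
the `t`-blowup of `K_{j+2} ∪ K*_{j+1}`, of order `n = (2j+3)t`, one has
`λ_2(A) - λ_{n-j}(A) = (j+2)·t`; in particular `(λ_2(A) - λ_{n-j}(A))/n = (j+2)/(2j+3)`, so
for every positive `n` divisible by `2j+3` there is a symmetric `n × n` `(0,1)`-matrix whose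
`(1,j)`-spread is at least `n·(j+2)/(2j+3)`. -/
theorem blowup_union_complete_spread (j t : ℕ) (ht : 1 ≤ t)
    (A : Matrix ((Fin (j + 2) ⊕ Fin (j + 1)) × Fin t)
        ((Fin (j + 2) ⊕ Fin (j + 1)) × Fin t) ℝ)
    (hAdef : A = (Matrix.fromBlocks
        ((Matrix.of fun (_ : Fin (j + 2)) (_ : Fin (j + 2)) => (1 : ℝ)) - 1) 0 0
        (Matrix.of fun (_ : Fin (j + 1)) (_ : Fin (j + 1)) => (1 : ℝ))) ⊗ₖ
      (Matrix.of fun (_ : Fin t) (_ : Fin t) => (1 : ℝ)))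
    (hA : A.IsHermitian) :
    (∀ μ : Fin ((2 * j + 3) * t) → ℝ, Antitone μ →
      Finset.univ.val.map μ = Finset.univ.val.map hA.eigenvalues →
      (μ ⟨1, lt_of_lt_of_le (by omega) (Nat.le_mul_of_pos_right (2 * j + 3) ht)⟩ -
          μ ⟨(2 * j + 3) * t - j - 1, by
            rw [Nat.sub_sub]
            exact Nat.sub_lt (Nat.mul_pos (by omega) ht) (by omega)⟩ = ((j : ℝ) + 2) * t ∧
       (μ ⟨1, lt_of_lt_of_le (by omega) (Nat.le_mul_of_pos_right (2 * j + 3) ht)⟩ -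
          μ ⟨(2 * j + 3) * t - j - 1, by
            rw [Nat.sub_sub]
            exact Nat.sub_lt (Nat.mul_pos (by omega) ht) (by omega)⟩) /
          (((2 * j + 3) * t : ℕ) : ℝ) = ((j : ℝ) + 2) / (2 * (j : ℝ) + 3))) ∧
    ∀ (n : ℕ) (hn0 : 0 < n) (hdvd : (2 * j + 3) ∣ n),
      ∃ B : Matrix (Fin n) (Fin n) ℝ, ∃ hB : B.IsHermitian,
        (∀ a b, B a b = 0 ∨ B a b = 1) ∧
        ∃ μ : Fin n → ℝ, Antitone μ ∧
          Finset.univ.val.map μ = Finset.univ.val.map hB.eigenvalues ∧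
          (n : ℝ) * ((j : ℝ) + 2) / (2 * (j : ℝ) + 3) ≤
            μ ⟨1, by have h := Nat.le_of_dvd hn0 hdvd; omega⟩ -
              μ ⟨n - j - 1, by omega⟩ := by
  have hc := aux_charpoly j t ht
  rw [← hAdef] at hc
  refine ⟨fun μ hμ he => ?_, ?_⟩
  · have h := aux_spread A hA j t _ rfl ht hc μ hμ he
      (lt_of_lt_of_le (by omega) (Nat.le_mul_of_pos_right (2 * j + 3) ht))
      (by rw [Nat.sub_sub]; exact Nat.sub_lt (Nat.mul_pos (by omega) ht) (by omega))
    refine ⟨h, ?_⟩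
    rw [h]
    have ht0 : (t : ℝ) ≠ 0 := by positivity
    push_cast
    field_simp
  · intro n hn0 hdvd
    obtain ⟨s, hs⟩ := hdvd
    have hs1 : 1 ≤ s := by
      rcases Nat.eq_zero_or_pos s with h | h
      · simp [h] at hs; omega
      · exact h
    have hc' := aux_charpoly j s hs1
    set M := (Matrix.fromBlocks
        ((Matrix.of fun (_ : Fin (j + 2)) (_ : Fin (j + 2)) => (1 : ℝ)) - 1) 0 0
        (Matrix.of fun (_ : Fin (j + 1)) (_ : Fin (j + 1)) => (1 : ℝ))) ⊗ₖ
      (Matrix.of fun (_ : Fin s) (_ : Fin s) => (1 : ℝ)) with hM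
    have h01 : ∀ a b, M a b = 0 ∨ M a b = 1 := by
      rintro ⟨a | a, x⟩ ⟨b | b, y⟩ <;> simp [hM, Matrix.one_apply]
      by_cases h : a = b <;> simp [h]
    have hsymm : M.IsHermitian := by
      ext ⟨a | a, x⟩ ⟨b | b, y⟩ <;> simp [hM, Matrix.one_apply, eq_comm]
    have hcard : Fintype.card ((Fin (j + 2) ⊕ Fin (j + 1)) × Fin s) = n := by
      simp only [Fintype.card_prod, Fintype.card_sum, Fintype.card_fin]
      rw [hs]; ring
    let e := Fintype.equivFinOfCardEq hcard
    have hB : (Matrix.reindex e e M).IsHermitian := by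
      simpa using hsymm.submatrix e.symm
    have hcB : (Matrix.reindex e e M).charpoly = _ := (Matrix.charpoly_reindex e M).trans hc'
    let μ : Fin n → ℝ := hB.eigenvalues₀ ∘ Fin.cast (Fintype.card_fin n).symm
    have hμ : Antitone μ := fun a b hab => hB.eigenvalues₀_antitone (by simpa using hab)
    have he : Finset.univ.val.map μ = Finset.univ.val.map hB.eigenvalues := by
      have h1 := hB.roots_charpoly_eq_eigenvalues₀
      have h2 := hB.roots_charpoly_eq_eigenvalues
      rw [h2] at h1
      have h3 : Finset.univ.val.map μ = Finset.univ.val.map hB.eigenvalues₀ := by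
        have : (Finset.univ.val.map (finCongr (Fintype.card_fin n).symm)) =
            Finset.univ.val := by
          exact Multiset.map_univ_val_equiv _
        rw [← this, Multiset.map_map]
        rfl
      rw [h3]
      exact h1.symm
    refine ⟨Matrix.reindex e e M, hB, fun a b => h01 _ _, μ, hμ, he, ?_⟩
    rw [aux_spread _ hB j s n hs hs1 hcB μ hμ he]
    apply le_of_eq
    rw [hs]
    push_cast
    field_simp
end
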